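/- arXiv:1907.08762 — 4 statements merged into one kernel-verified Lean document; each statement's English description precedes it below -/
import Mathlib

section
/- Every Ps-normal topological space is CC-normal. -/
open Set Topology Filter

universe u v

/-- A subset `K` of a topological space is pseudocompact if every continuous
real-valued function on `K` (with the subspace topology) is bounded. -/
def IsPseudocompactSet {X : Type u} [TopologicalSpace X] (K : Set X) : Prop :=
  ∀ f : K → ℝ, Continuous f → ∃ M : ℝ, ∀ x : K, |f x| ≤ M

/-- A subset `K` is countably compact if every countable open cover of `K`
has a finite subcover. -/
def IsCountablyCompactSet {X : Type u} [TopologicalSpace X] (K : Set X) : Prop :=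
  ∀ U : ℕ → Set X, (∀ n, IsOpen (U n)) → K ⊆ ⋃ n, U n →
    ∃ t : Finset ℕ, K ⊆ ⋃ n ∈ t, U n

/-- `f` restricts to a homeomorphism of `K` onto `f '' K`
(both with their subspace topologies). -/
def RestrictsToHomeo {X : Type u} {Y : Type v} [TopologicalSpace X] [TopologicalSpace Y]
    (f : X → Y) (K : Set X) : Prop :=
  ∃ e : K ≃ₜ (f '' K), ∀ x : K, (e x : Y) = f x

/-- `X` is Ps-normal. -/
def PsNormal (X : Type u) [TopologicalSpace X] : Prop :=
  ∃ (Y : Type u) (_ : TopologicalSpace Y) (f : X → Y), NormalSpace Y ∧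
    Function.Bijective f ∧ ∀ K : Set X, IsPseudocompactSet K → RestrictsToHomeo f K

/-- `X` is CC-normal. -/
def CCNormal (X : Type u) [TopologicalSpace X] : Prop :=
  ∃ (Y : Type u) (_ : TopologicalSpace Y) (f : X → Y), NormalSpace Y ∧
    Function.Bijective f ∧ ∀ K : Set X, IsCountablyCompactSet K → RestrictsToHomeo f K

/-- `X` is C-normal. -/
def CNormal (X : Type u) [TopologicalSpace X] : Prop :=
  ∃ (Y : Type u) (_ : TopologicalSpace Y) (f : X → Y), NormalSpace Y ∧
    Function.Bijective f ∧ ∀ K : Set X, IsCompact K → RestrictsToHomeo f K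

/-- `X` is Ps-Tychonoff. -/
def PsTychonoff (X : Type u) [TopologicalSpace X] : Prop :=
  ∃ (Y : Type u) (_ : TopologicalSpace Y) (f : X → Y), T35Space Y ∧
    Function.Bijective f ∧ ∀ K : Set X, IsPseudocompactSet K → RestrictsToHomeo f K

/-- `X` is C-Tychonoff. -/
def CTychonoff (X : Type u) [TopologicalSpace X] : Prop :=
  ∃ (Y : Type u) (_ : TopologicalSpace Y) (f : X → Y), T35Space Y ∧
    Function.Bijective f ∧ ∀ K : Set X, IsCompact K → RestrictsToHomeo f K

/-- `X` is L-Tychonoff. -/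
def LTychonoff (X : Type u) [TopologicalSpace X] : Prop :=
  ∃ (Y : Type u) (_ : TopologicalSpace Y) (f : X → Y), T35Space Y ∧
    Function.Bijective f ∧ ∀ K : Set X, IsLindelof K → RestrictsToHomeo f K

/-- A countably compact subset is pseudocompact. -/
theorem IsCountablyCompactSet.isPseudocompactSet {X : Type u} [TopologicalSpace X] {K : Set X}
    (hK : IsCountablyCompactSet K) : IsPseudocompactSet K := by
  intro f hf
  have hopen (n : ℕ) : IsOpen {x : K | |f x| < n} := isOpen_lt hf.abs continuous_const
  choose U hU hUf using fun n => isOpen_induced_iff.mp (hopen n)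
  have hmem (n : ℕ) (x : K) : (x : X) ∈ U n ↔ |f x| < n := Set.ext_iff.mp (hUf n) x
  obtain ⟨t, ht⟩ := hK U hU fun x hx => by
    obtain ⟨n, hn⟩ := exists_nat_gt |f ⟨x, hx⟩|
    exact mem_iUnion.mpr ⟨n, (hmem n ⟨x, hx⟩).mpr hn⟩
  refine ⟨(t.sup id : ℕ), fun x => ?_⟩
  obtain ⟨n, hn, hx⟩ := mem_iUnion₂.mp (ht x.2)
  exact ((hmem n x).mp hx).le.trans (Nat.cast_le.mpr (Finset.le_sup (f := id) hn))

/-- Every Ps-normal topological space is CC-normal. -/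
theorem psNormal_isCCNormal {X : Type u} [TopologicalSpace X] (h : PsNormal X) :
    CCNormal X := by
  obtain ⟨Y, hY, f, hnormal, hbij, hf⟩ := h
  exact ⟨Y, hY, f, hnormal, hbij, fun K hK => hf K hK.isPseudocompactSet⟩
end

section
/- If X is a C-normal topological space and every pseudocompact subset of X is contained in some compact subset of X, then X is Ps-normal. -/
open Set Topology Filter

universe u v

theorem restrictsToHomeo_iff_isEmbedding_domRestrict {X : Type u} {Y : Type v}
    [TopologicalSpace X] [TopologicalSpace Y] {f : X → Y} {K : Set X} :
    RestrictsToHomeo f K ↔ IsEmbedding (K.domRestrict f) := by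
  constructor
  · rintro ⟨e, he⟩
    have hf : K.domRestrict f = Subtype.val ∘ e := funext fun x => (he x).symm
    exact hf ▸ IsEmbedding.subtypeVal.comp e.isEmbedding
  · intro hf
    exact ⟨hf.toHomeomorph.trans (Homeomorph.setCongr (range_domRestrict f K)), fun _ => rfl⟩

theorem RestrictsToHomeo.mono {X : Type u} {Y : Type v} [TopologicalSpace X]
    [TopologicalSpace Y] {f : X → Y} {K A : Set X} (hA : RestrictsToHomeo f A) (hKA : K ⊆ A) :
    RestrictsToHomeo f K := by
  rw [restrictsToHomeo_iff_isEmbedding_domRestrict] at hA ⊢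
  exact hA.comp (IsEmbedding.inclusion hKA)

/-- If `X` is C-normal and every pseudocompact subset of `X` is contained in some
compact subset of `X`, then `X` is Ps-normal. -/
theorem cNormal_isPsNormal {X : Type u} [TopologicalSpace X] (h : CNormal X)
    (hc : ∀ K : Set X, IsPseudocompactSet K → ∃ A : Set X, IsCompact A ∧ K ⊆ A) :
    PsNormal X := by
  obtain ⟨Y, _, f, hY, hf, hK⟩ := h
  refine ⟨Y, _, f, hY, hf, fun K hps => ?_⟩
  obtain ⟨A, hA, hKA⟩ := hc K hps
  exact (hK A hA).mono hKA
end

section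
/- If X is a CC-normal topological space and every pseudocompact subset of X is contained in some countably compact subset of X, then X is Ps-normal. -/
open Set Topology Filter

universe u v

/-- If `X` is CC-normal and every pseudocompact subset of `X` is contained in some
countably compact subset of `X`, then `X` is Ps-normal. -/
theorem ccNormal_isPsNormal {X : Type u} [TopologicalSpace X] (h : CCNormal X)
    (hc : ∀ K : Set X, IsPseudocompactSet K → ∃ A : Set X, IsCountablyCompactSet A ∧ K ⊆ A) :
    PsNormal X := by
  obtain ⟨Y, tY, f, hY, hf, hcc⟩ := h
  refine ⟨Y, tY, f, hY, hf, fun K hK => ?_⟩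
  obtain ⟨A, hA, hKA⟩ := hc K hK
  exact (hcc A hA).mono hKA
end

section
/- If X is a T1 topological space in which every pseudocompact subset is finite, then X is Ps-Tychonoff. -/
open Set Topology Filter

universe u v

theorem RestrictsToHomeo.of_finite {X : Type u} {Y : Type v} [TopologicalSpace X]
    [TopologicalSpace Y] [T1Space X] [T1Space Y] {f : X → Y} {K : Set X}
    (hf : InjOn f K) (hK : K.Finite) : RestrictsToHomeo f K := by
  have : Finite K := hK
  have : Finite (f '' K) := hK.image f
  exact ⟨(Equiv.Set.imageOfInjOn f K hf).toHomeomorphOfDiscrete, fun _ => rfl⟩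

/-- If `X` is a T₁ space in which every pseudocompact subset is finite,
then `X` is Ps-Tychonoff. -/
theorem psTychonoff_of_t1_pseudocompact_finite {X : Type u} [TopologicalSpace X]
    [T1Space X] (h : ∀ K : Set X, IsPseudocompactSet K → K.Finite) :
    PsTychonoff X := by
  refine ⟨X, ⊥, id, ?_, Function.bijective_id, fun K hK => ?_⟩
  · let _ : TopologicalSpace X := ⊥
    have : DiscreteTopology X := ⟨rfl⟩
    infer_instance
  · exact @RestrictsToHomeo.of_finite X X _ ⊥ _ (t1Space_antitone bot_le ‹_›) id K
      (injOn_id K) (h K hK)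
end
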